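/- arXiv:2311.18753 — 2 statements merged into one kernel-verified Lean document; each statement's English description precedes it below -/
import Mathlib

section
/- Let n, r, e be integers with n ≥ r ≥ 3 and 1 ≤ e ≤ C(n,2). Then the minimum of N(K_r, G) over all graphs G in the family K(n,e) equals h_r*(n,e). -/
/-- Number of edges of a (simple) graph. -/
noncomputable def edgeCnt {V : Type*} (G : SimpleGraph V) : ℕ := G.edgeSet.ncard

/-- `NK G r` is the number of `r`-cliques in `G`. -/
noncomputable def NK {V : Type*} (G : SimpleGraph V) (r : ℕ) : ℕ :=
  {s : Finset V | G.IsNClique r s}.ncard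

/-- Clique count with an integer index: `N(K_r, G) = 0` for `r < 0`. -/
noncomputable def NKZ {V : Type*} (G : SimpleGraph V) (r : ℤ) : ℕ :=
  if r < 0 then 0 else NK G r.toNat

/-- `tur s n` is the number of edges of the Turán graph `T_s(n)`. -/
noncomputable def tur (s n : ℕ) : ℕ := edgeCnt (SimpleGraph.turanGraph n s)

/-- `kk n e = k(n,e)`, the least `s ≥ 1` with `t_s(n) ≥ e`. -/
noncomputable def kk (n e : ℕ) : ℕ := sInf {s : ℕ | 1 ≤ s ∧ e ≤ tur s n}

/-- `a_k*(n,e)`, the least `a ≥ 1` with `a(n-a) + t_{k-1}(n-a) ≥ e`. -/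
noncomputable def aLast (n e : ℕ) : ℕ :=
  sInf {a : ℕ | 1 ≤ a ∧ e ≤ a * (n - a) + tur (kk n e - 1) (n - a)}

/-- `aStar n e i = a_i*(n,e)` for `i ∈ [k]` (1-indexed):
the unique vector with `a_k* = aLast n e`, `a_1* + ⋯ + a_{k-1}* = n - a_k*` and
`a_1* ≥ ⋯ ≥ a_{k-1}* ≥ a_1* - 1`. -/
noncomputable def aStar (n e i : ℕ) : ℕ :=
  if i = kk n e then aLast n e
  else (n - aLast n e) / (kk n e - 1) +
    (if i ≤ (n - aLast n e) % (kk n e - 1) then 1 else 0)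

/-- `m*(n,e) = Σ_{i<j} a_i* a_j* - e` (as a natural number). -/
noncomputable def mStar (n e : ℕ) : ℕ :=
  (∑ p ∈ (Finset.Icc 1 (kk n e)).powersetCard 2, ∏ i ∈ p, aStar n e i) - e

/-- `m*(n,e) = Σ_{i<j} a_i* a_j* - e` (as an integer). -/
noncomputable def mStarZ (n e : ℕ) : ℤ :=
  (∑ p ∈ (Finset.Icc 1 (kk n e)).powersetCard 2, ∏ i ∈ p, (aStar n e i : ℤ)) - (e : ℤ)

/-- `h_r*(n,e) = Σ_{I ⊆ [k], |I|=r} Π_{i∈I} a_i* - m* Σ_{I' ⊆ [k-2], |I'|=r-2} Π_{j∈I'} a_j*`. -/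
noncomputable def hStar (n e r : ℕ) : ℤ :=
  (∑ I ∈ (Finset.Icc 1 (kk n e)).powersetCard r, ∏ i ∈ I, (aStar n e i : ℤ)) -
    (mStar n e : ℤ) *
      ∑ I ∈ (Finset.Icc 1 (kk n e - 2)).powersetCard (r - 2), ∏ i ∈ I, (aStar n e i : ℤ)

/-- Membership in the family `K(n,e)`: `(n,e)`-graphs obtained from a complete multipartite
graph by adding a triangle-free graph into one part. -/
def MemK (n e : ℕ) (G : SimpleGraph (Fin n)) : Prop :=
  edgeCnt G = e ∧
  ∃ (c : Fin n → ℕ) (j₀ : ℕ),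
    (∀ u v, c u ≠ c v → G.Adj u v) ∧
    (∀ u v, G.Adj u v → c u = c v → c u = j₀) ∧
    (G.induce {v | c v = j₀}).CliqueFree 3

/-- Membership in the family `H_1(n,e)`: `(n,e)`-graphs obtained from a complete
`(k-1)`-partite graph by adding a triangle-free graph into one part. -/
def MemH1 (n e : ℕ) (G : SimpleGraph (Fin n)) : Prop :=
  edgeCnt G = e ∧
  ∃ (c : Fin n → Fin (kk n e - 1)) (j₀ : Fin (kk n e - 1)),
    (∀ u v, c u ≠ c v → G.Adj u v) ∧
    (∀ u v, G.Adj u v → c u = c v → c u = j₀) ∧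
    (G.induce {v | c v = j₀}).CliqueFree 3

/-- Membership in the family `H_0(n,e)`: `(n,e)`-graphs obtained from a complete
`(k-1)`-partite graph by adding a (possibly empty) triangle-free graph into each part. -/
def MemH0 (n e : ℕ) (G : SimpleGraph (Fin n)) : Prop :=
  edgeCnt G = e ∧
  ∃ c : Fin n → Fin (kk n e - 1),
    (∀ u v, c u ≠ c v → G.Adj u v) ∧
    ∀ j, (G.induce {v | c v = j}).CliqueFree 3

/-- Membership (up to isomorphism) in the family `H_1*(n,e)`: graphs obtained from the
complete `k`-partite graph with part sizes `a_1*, …, a_k*` by replacing, for some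
`i ∈ [k-1]` (with `i = k-1` if `m* > 0`), the complete bipartite graph between parts `i`
and `k` by an arbitrary triangle-free graph on the union of these two parts with
`a_i* a_k* - m*` edges. -/
def MemH1star (n e : ℕ) (G : SimpleGraph (Fin n)) : Prop :=
  edgeCnt G = e ∧
  ∃ (c : Fin n → ℕ) (i : ℕ),
    (∀ v, c v ∈ Finset.Icc 1 (kk n e)) ∧
    (∀ j ∈ Finset.Icc 1 (kk n e), {v | c v = j}.ncard = aStar n e j) ∧
    i ∈ Finset.Icc 1 (kk n e - 1) ∧
    (0 < mStar n e → i = kk n e - 1) ∧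
    (∀ u v, c u ≠ c v →
      (c u ∉ ({i, kk n e} : Set ℕ) ∨ c v ∉ ({i, kk n e} : Set ℕ)) → G.Adj u v) ∧
    (∀ u v, G.Adj u v → c u = c v → c u = i ∨ c u = kk n e) ∧
    (G.induce {v | c v = i ∨ c v = kk n e}).CliqueFree 3

/-- Membership (up to isomorphism) in the family `H_2*(n,e)`. -/
def MemH2star (n e : ℕ) (G : SimpleGraph (Fin n)) : Prop :=
  (MemH1star n e G ∧ G.Colorable (kk n e)) ∨
  (edgeCnt G = e ∧
   ∃ (c : Fin n → ℕ) (sz : ℕ → ℕ) (f : Fin n → ℕ),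
     ((∀ j, sz j = aStar n e j) ∨
      (mStar n e = 0 ∧ aStar n e (kk n e) + 2 ≤ aStar n e 1 ∧
       (∀ j ∈ Finset.Icc 1 (kk n e - 2), sz j = aStar n e (j + 1)) ∧
       sz (kk n e - 1) = aStar n e 1 - 1 ∧ sz (kk n e) = aStar n e (kk n e) + 1)) ∧
     (∀ v, c v ∈ Finset.Icc 1 (kk n e)) ∧
     (∀ j ∈ Finset.Icc 1 (kk n e), {v | c v = j}.ncard = sz j) ∧
     (∀ u v, G.Adj u v → c u ≠ c v) ∧
     (∀ u v, c u ≠ c v → ¬ G.Adj u v → c v = kk n e →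
        c u ∈ Finset.Icc 1 (kk n e - 1) ∧ sz (c u) = sz (kk n e - 1) ∧ c u = f v) ∧
     (∀ u v, c u ≠ c v → ¬ G.Adj u v → c u = kk n e ∨ c v = kk n e))

/-- Partial sums of the part sizes `a_i*`. -/
noncomputable def csum (n e j : ℕ) : ℕ := ∑ i ∈ Finset.Icc 1 j, aStar n e i

/-- The part (in `[k]`) of the vertex with index `v` in the canonical construction. -/
noncomputable def partOf (n e v : ℕ) : ℕ := sInf {j : ℕ | v < csum n e j}

/-- The graph `H*(n,e)`: the complete `k`-partite graph with part sizes `a_1*, …, a_k*`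
minus an `m*`-edge star whose centre lies in part `k` and whose leaves lie in part `k-1`. -/
noncomputable def HstarG (n e : ℕ) : SimpleGraph (Fin n) :=
  SimpleGraph.fromRel (fun u v =>
    partOf n e u ≠ partOf n e v ∧
    ¬ (((u : ℕ) = csum n e (kk n e - 1) ∧
          csum n e (kk n e - 2) ≤ (v : ℕ) ∧
          (v : ℕ) < csum n e (kk n e - 2) + mStar n e) ∨
       ((v : ℕ) = csum n e (kk n e - 1) ∧
          csum n e (kk n e - 2) ≤ (u : ℕ) ∧
          (u : ℕ) < csum n e (kk n e - 2) + mStar n e)))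

/-- `g_r(n,e)`: the minimum number of `r`-cliques among all graphs with `n` vertices and
`e` edges. -/
noncomputable def gMin (n e r : ℕ) : ℕ :=
  sInf {N : ℕ | ∃ G : SimpleGraph (Fin n), edgeCnt G = e ∧ NK G r = N}

open Polynomial in
/-- The generating polynomial of the elementary symmetric functions of a multiset of naturals. -/
noncomputable def partPoly (Z : Multiset ℕ) : ℕ[X] := (Z.map fun z => 1 + C z * X).prod

open Polynomial in
/-- The clique polynomial of the join of independent sets with sizes `Z` and a triangle-free graph
with `b` vertices and `t` edges. -/
noncomputable def joinPoly (Z : Multiset ℕ) (b t : ℕ) : ℕ[X] :=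
  (1 + C b * X + C t * X ^ 2) * partPoly Z

section JoinPoly

open Polynomial

lemma partPoly_cons (z : ℕ) (Z : Multiset ℕ) :
    partPoly (z ::ₘ Z) = (1 + C z * X) * partPoly Z := by
  simp [partPoly]

lemma partPoly_coeff_zero (Z : Multiset ℕ) : (partPoly Z).coeff 0 = 1 := by
  induction Z using Multiset.induction_on with
  | empty => simp [partPoly]
  | cons z Z ih => simp [partPoly_cons, mul_coeff_zero, ih]

lemma partPoly_coeff_one (Z : Multiset ℕ) : (partPoly Z).coeff 1 = Z.sum := by
  induction Z using Multiset.induction_on with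
  | empty => simp [partPoly, coeff_one]
  | cons z Z ih =>
    rw [partPoly_cons, add_mul, one_mul, mul_assoc, coeff_add, coeff_C_mul, coeff_X_mul,
      partPoly_coeff_zero, ih, Multiset.sum_cons]
    ring

lemma two_mul_partPoly_coeff_two (Z : Multiset ℕ) :
    2 * (partPoly Z).coeff 2 + (Z.map fun z => z ^ 2).sum = Z.sum ^ 2 := by
  induction Z using Multiset.induction_on with
  | empty => simp [partPoly, coeff_one]
  | cons z Z ih =>
    rw [partPoly_cons, add_mul, one_mul, mul_assoc, coeff_add, coeff_C_mul, coeff_X_mul,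
      partPoly_coeff_one, Multiset.sum_cons, Multiset.map_cons, Multiset.sum_cons]
    linarith

lemma partPoly_natDegree_le (Z : Multiset ℕ) : (partPoly Z).natDegree ≤ Z.card := by
  induction Z using Multiset.induction_on with
  | empty => simp [partPoly]
  | cons z Z ih =>
    have h : (1 + C z * X : ℕ[X]).natDegree ≤ 1 := by compute_degree
    rw [partPoly_cons, Multiset.card_cons]
    exact natDegree_mul_le.trans (by omega)

lemma joinPoly_natDegree_le (Z : Multiset ℕ) (b t : ℕ) :
    (joinPoly Z b t).natDegree ≤ Z.card + 2 := by
  have h : (1 + C b * X + C t * X ^ 2 : ℕ[X]).natDegree ≤ 2 := by compute_degree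
  have := partPoly_natDegree_le Z
  exact natDegree_mul_le.trans (by omega)

lemma joinPoly_coeff_one (Z : Multiset ℕ) (b t : ℕ) : (joinPoly Z b t).coeff 1 = Z.sum + b := by
  rw [joinPoly, add_mul, add_mul, one_mul, mul_assoc, mul_assoc, coeff_add, coeff_add, coeff_C_mul,
    coeff_C_mul, coeff_X_mul, coeff_X_pow_mul', partPoly_coeff_zero, partPoly_coeff_one]
  simp

lemma joinPoly_coeff_two (Z : Multiset ℕ) (b t : ℕ) :
    (joinPoly Z b t).coeff 2 = (partPoly Z).coeff 2 + b * Z.sum + t := by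
  rw [joinPoly, add_mul, add_mul, one_mul, mul_assoc, mul_assoc, coeff_add, coeff_add, coeff_C_mul,
    coeff_C_mul, coeff_X_mul, coeff_X_pow_mul', partPoly_coeff_one]
  simp [partPoly_coeff_zero]

lemma joinPoly_cons (z : ℕ) (Z : Multiset ℕ) (b t : ℕ) :
    joinPoly (z ::ₘ Z) b t =
      (1 + C (z + b) * X + C (z * b + t) * X ^ 2) * partPoly Z + C (z * t) * (X ^ 3 * partPoly Z) := by
  simp only [joinPoly, partPoly_cons, C_add, C_mul]
  ring

lemma joinPoly_cons_coeff_le {z b t z' b' t' : ℕ} (Z : Multiset ℕ) (h1 : z' + b' = z + b)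
    (h2 : z' * b' + t' = z * b + t) (h3 : z' * t' ≤ z * t) (i : ℕ) :
    (joinPoly (z' ::ₘ Z) b' t').coeff i ≤ (joinPoly (z ::ₘ Z) b t).coeff i := by
  rw [joinPoly_cons, joinPoly_cons, h1, h2, coeff_add, coeff_add, coeff_C_mul, coeff_C_mul]
  gcongr

lemma joinPoly_cons_coeff_eq {z b t z' b' t' : ℕ} (Z : Multiset ℕ) (h1 : z' + b' = z + b)
    (h2 : z' * b' + t' = z * b + t) {i : ℕ} (hi : i < 3) :
    (joinPoly (z' ::ₘ Z) b' t').coeff i = (joinPoly (z ::ₘ Z) b t).coeff i := by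
  rw [joinPoly_cons, joinPoly_cons, h1, h2, coeff_add, coeff_add, coeff_C_mul, coeff_C_mul,
    coeff_X_pow_mul', if_neg (by omega)]
  simp

lemma joinPoly_cons_coeff_three_lt {z b t z' b' t' : ℕ} (Z : Multiset ℕ) (h1 : z' + b' = z + b)
    (h2 : z' * b' + t' = z * b + t) (h3 : z' * t' < z * t) :
    (joinPoly (z' ::ₘ Z) b' t').coeff 3 < (joinPoly (z ::ₘ Z) b t).coeff 3 := by
  rw [joinPoly_cons, joinPoly_cons, h1, h2, coeff_add, coeff_add, coeff_C_mul, coeff_C_mul,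
    coeff_X_pow_mul', if_pos le_rfl, Nat.sub_self, partPoly_coeff_zero]
  omega

lemma joinPoly_zero_cons (Z : Multiset ℕ) (b t : ℕ) : joinPoly (0 ::ₘ Z) b t = joinPoly Z b t := by
  simp [joinPoly, partPoly_cons]

end JoinPoly

/-- The least `a` for which a complete bipartite graph with parts `a` and `b - a` has at least
`t` edges. -/
lemma exists_bipartition_excess {b t : ℕ} (ht : 0 < t) (hbt : 4 * t ≤ b ^ 2) :
    ∃ x a m : ℕ, 1 ≤ a ∧ b = x + a ∧ x * a = t + m ∧ m + a ≤ x := by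
  have hex : ∃ a, a ≤ b ∧ t ≤ (b - a) * a := by
    refine ⟨b / 2, by omega, ?_⟩
    obtain ⟨c, rfl | rfl⟩ := b.even_or_odd'
    · rw [show 2 * c / 2 = c by omega, show 2 * c - c = c by omega]; nlinarith
    · rw [show (2 * c + 1) / 2 = c by omega, show 2 * c + 1 - c = c + 1 by omega]; nlinarith
  classical
  obtain ⟨hle, hge⟩ := Nat.find_spec hex
  have hmin : ∀ j < Nat.find hex, ¬ (j ≤ b ∧ t ≤ (b - j) * j) := fun j hj => Nat.find_min hex hj
  generalize Nat.find hex = a at *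
  have ha : 1 ≤ a := by
    rcases Nat.eq_zero_or_pos a with rfl | h
    · omega
    · exact h
  obtain ⟨x, rfl⟩ := Nat.exists_eq_add_of_le' hle
  rw [Nat.add_sub_cancel] at hge
  obtain ⟨m, hm⟩ := Nat.exists_eq_add_of_le hge
  refine ⟨x, a, m, ha, rfl, hm, ?_⟩
  have h1 := hmin (a - 1) (by omega)
  obtain ⟨a, rfl⟩ := Nat.exists_eq_add_of_le' ha
  rw [show x + (a + 1) - (a + 1 - 1) = x + 1 by omega, Nat.add_sub_cancel] at h1
  have : (x + 1) * a < t := by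
    by_contra hcon
    exact h1 ⟨by omega, by omega⟩
  nlinarith

/-- If a part of size `z` is not nearly as large as the larger part of the best bipartition, then
the edges between it and the triangle-free part can be rearranged with fewer triangles, or with no
more triangles and a larger part. -/
lemma exists_improved_triple {z x a m t : ℕ} (hxa : x * a = t + m) (hm : m + a ≤ x)
    (hbig : (z + (x + a)) ^ 2 < 4 * (z * (x + a) + t)) (hz : z ≠ x) (hz' : z ≠ x + 1) :
    ∃ z' b' t' : ℕ, z' + b' = z + (x + a) ∧ z' * b' + t' = z * (x + a) + t ∧ 4 * t' ≤ b' ^ 2 ∧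
      (z' * t' < z * t ∨ z' * t' ≤ z * t ∧ b' < x + a) := by
  rcases lt_or_ge z x with h | h
  · have hpos : m ≤ z * a := by
      zify at *
      nlinarith [sq_nonneg ((x : ℤ) - (z + a))]
    obtain ⟨t', ht'⟩ := Nat.exists_eq_add_of_le hpos
    refine ⟨x, z + a, t', by ring, by nlinarith, by zify at *; nlinarith [sq_nonneg ((z : ℤ) - a)],
      Or.inr ⟨?_, by omega⟩⟩
    nlinarith
  · obtain ⟨d, rfl⟩ : ∃ d, z = x + 2 + d := Nat.exists_eq_add_of_le (by omega)
    have hkey : ((x : ℤ) + 1 + d) * (a - 1 - d) < t := by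
      zify at *
      nlinarith
    have hnn : (0 : ℤ) ≤ t + a - 1 - d := by
      zify at *
      nlinarith [sq_nonneg ((x : ℤ) + 1 + d - (x + a + 1))]
    obtain ⟨t', ht'⟩ := Int.eq_ofNat_of_zero_le hnn
    refine ⟨x + 1 + d, x + a + 1, t', by ring, ?_, ?_, Or.inl ?_⟩
    · zify; rw [← ht']; ring
    · zify at *; rw [← ht']; nlinarith [sq_nonneg ((x : ℤ) + 1 - a)]
    · zify; rw [← ht']; nlinarith

/-- Every join of independent sets with a triangle-free graph can be replaced by a nearly balanced
one without increasing any clique count. -/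
lemma exists_balanced_joinPoly (Z : Multiset ℕ) (b t : ℕ) (hbt : 4 * t ≤ b ^ 2)
    (he : 0 < (joinPoly Z b t).coeff 2) :
    ∃ (Z' : Multiset ℕ) (x a m t' : ℕ), 1 ≤ a ∧ x * a = t' + m ∧ m + a ≤ x ∧
      (∀ z ∈ Z', z = x ∨ z = x + 1) ∧
      (∀ i < 3, (joinPoly Z' (x + a) t').coeff i = (joinPoly Z b t).coeff i) ∧
      ∀ i, (joinPoly Z' (x + a) t').coeff i ≤ (joinPoly Z b t).coeff i := by
  induction hc : Z.card using Nat.strong_induction_on generalizing Z b t with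
  | _ c ihc =>
  induction hN : (joinPoly Z b t).coeff 3 using Nat.strong_induction_on generalizing Z b t with
  | _ N ihN =>
  induction b using Nat.strong_induction_on generalizing Z t with
  | _ b ihb =>
  by_cases hsmall : ∃ z ∈ Z, 4 * (z * b + t) ≤ (z + b) ^ 2
  · obtain ⟨z, hzZ, hz⟩ := hsmall
    obtain ⟨Z, rfl⟩ := Multiset.exists_cons_of_mem hzZ
    have hle : ∀ i, (joinPoly Z (z + b) (z * b + t)).coeff i ≤
        (joinPoly (z ::ₘ Z) b t).coeff i := fun i => by
      rw [← joinPoly_zero_cons]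
      exact joinPoly_cons_coeff_le Z (by ring) (by ring) (by simp) i
    have heq : ∀ i < 3, (joinPoly Z (z + b) (z * b + t)).coeff i =
        (joinPoly (z ::ₘ Z) b t).coeff i := fun i hi => by
      rw [← joinPoly_zero_cons]
      exact joinPoly_cons_coeff_eq Z (by ring) (by ring) hi
    obtain ⟨Z', x, a, m, t', h1, h2, h3, h4, h5, h6⟩ := ihc Z.card
      (by rw [← hc, Multiset.card_cons]; omega) Z _ _ hz (by rwa [heq 2 (by norm_num)]) rfl
    exact ⟨Z', x, a, m, t', h1, h2, h3, h4, fun i hi => (h5 i hi).trans (heq i hi),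
      fun i => (h6 i).trans (hle i)⟩
  · push Not at hsmall
    have ht : 0 < t := by
      rcases Multiset.empty_or_exists_mem Z with rfl | ⟨z, hz⟩
      · simpa [joinPoly_coeff_two, partPoly, Polynomial.coeff_one] using he
      · have := hsmall z hz
        zify at *
        nlinarith [sq_nonneg ((z : ℤ) - b)]
    obtain ⟨x, a, m, ha, rfl, hxa, hm⟩ := exists_bipartition_excess ht hbt
    by_cases hall : ∀ z ∈ Z, z = x ∨ z = x + 1
    · exact ⟨Z, x, a, m, t, ha, hxa, hm, hall, fun _ _ => rfl, fun _ => le_rfl⟩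
    · push Not at hall
      obtain ⟨z, hzZ, hz1, hz2⟩ := hall
      obtain ⟨z', b', t', hs, hE, hbt', himp⟩ :=
        exists_improved_triple hxa hm (hsmall z hzZ) hz1 hz2
      obtain ⟨Z, rfl⟩ := Multiset.exists_cons_of_mem hzZ
      have heq : ∀ i < 3, (joinPoly (z' ::ₘ Z) b' t').coeff i =
          (joinPoly (z ::ₘ Z) (x + a) t).coeff i := fun i => joinPoly_cons_coeff_eq Z hs hE
      have hT : z' * t' ≤ z * t := by omega
      have hle := joinPoly_cons_coeff_le Z hs hE hT
      have hcard : (z' ::ₘ Z).card = c := by rw [← hc]; simp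
      have hpos : 0 < (joinPoly (z' ::ₘ Z) b' t').coeff 2 := by rwa [heq 2 (by norm_num)]
      obtain ⟨Z', x', a', m', t'', h1, h2, h3, h4, h5, h6⟩ :
          ∃ (Z' : Multiset ℕ) (x a m t'' : ℕ), 1 ≤ a ∧ x * a = t'' + m ∧ m + a ≤ x ∧
            (∀ z ∈ Z', z = x ∨ z = x + 1) ∧
            (∀ i < 3, (joinPoly Z' (x + a) t'').coeff i =
              (joinPoly (z' ::ₘ Z) b' t').coeff i) ∧
            ∀ i, (joinPoly Z' (x + a) t'').coeff i ≤ (joinPoly (z' ::ₘ Z) b' t').coeff i := by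
        rcases (hle 3).lt_or_eq with h3 | h3
        · exact ihN _ (hN ▸ h3) _ _ _ hbt' hpos hcard rfl
        · refine ihb b' ?_ _ _ hbt' hpos hcard (h3.trans hN)
          rcases himp with h | ⟨_, h⟩
          · exact absurd h3 (joinPoly_cons_coeff_three_lt Z hs hE h).ne
          · exact h
      exact ⟨Z', x', a', m', t'', h1, h2, h3, h4, fun i hi => (h5 i hi).trans (heq i hi),
        fun i => (h6 i).trans (hle i)⟩

/-- Every admissible number of vertices and edges is attained by some join. -/
lemma exists_joinPoly (n e : ℕ) (he : e ≤ n.choose 2) :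
    ∃ (Z : Multiset ℕ) (b t : ℕ), 4 * t ≤ b ^ 2 ∧ (joinPoly Z b t).coeff 1 = n ∧
      (joinPoly Z b t).coeff 2 = e := by
  by_cases hsmall : 4 * e ≤ n ^ 2
  · exact ⟨0, n, e, hsmall, by simp [joinPoly_coeff_one],
      by simp [joinPoly_coeff_two, partPoly, Polynomial.coeff_one]⟩
  induction n generalizing e with
  | zero => simp at he; simp [he] at hsmall
  | succ n ih =>
    have hn : n ≤ e := by nlinarith [sq_nonneg ((n : ℤ) - 1)]
    obtain ⟨e, rfl⟩ := Nat.exists_eq_add_of_le hn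
    rw [Nat.choose_succ_succ' n 1, Nat.choose_one_right, one_add_one_eq_two] at he
    obtain ⟨Z, b, t, h1, h2, h3⟩ : ∃ (Z : Multiset ℕ) (b t : ℕ), 4 * t ≤ b ^ 2 ∧
        (joinPoly Z b t).coeff 1 = n ∧ (joinPoly Z b t).coeff 2 = e := by
      by_cases h : 4 * e ≤ n ^ 2
      · exact ⟨0, n, e, h, by simp [joinPoly_coeff_one],
          by simp [joinPoly_coeff_two, partPoly, Polynomial.coeff_one]⟩
      · exact ih e (by omega) h
    have hcons : joinPoly (1 ::ₘ Z) b t =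
        joinPoly Z b t + Polynomial.X * joinPoly Z b t := by
      simp only [joinPoly, partPoly_cons, Polynomial.C_1]; ring
    have h0 : (joinPoly Z b t).coeff 0 = 1 := by
      simp [joinPoly, Polynomial.mul_coeff_zero, partPoly_coeff_zero]
    refine ⟨1 ::ₘ Z, b, t, h1, ?_, ?_⟩
    · rw [hcons, Polynomial.coeff_add, Polynomial.coeff_X_mul, h2, h0]
    · rw [hcons, Polynomial.coeff_add, Polynomial.coeff_X_mul, h2, h3, add_comm]

section CliquePoly

open Polynomial

variable {V : Type*}

open Classical in
/-- The clique polynomial of `G` restricted to the vertices in `S`. -/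
noncomputable def cliquePolyOn (G : SimpleGraph V) (S : Finset V) : ℕ[X] :=
  ∑ s ∈ S.powerset.filter fun s : Finset V => G.IsClique s, X ^ s.card

open Classical in
lemma cliquePolyOn_coeff (G : SimpleGraph V) (S : Finset V) (r : ℕ) :
    (cliquePolyOn G S).coeff r = (S.powerset.filter fun s => G.IsNClique r s).card := by
  simp only [cliquePolyOn, finsetSum_coeff, coeff_X_pow, Finset.sum_boole, Finset.filter_filter,
    SimpleGraph.isNClique_iff, eq_comm, Nat.cast_id]

lemma NK_eq_coeff [Fintype V] (G : SimpleGraph V) (r : ℕ) :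
    NK G r = (cliquePolyOn G Finset.univ).coeff r := by
  classical
  rw [cliquePolyOn_coeff, NK, ← Set.ncard_coe_finset]
  congr 1
  ext s
  simp

lemma NK_two (G : SimpleGraph V) : NK G 2 = edgeCnt G := by
  classical
  symm
  refine Set.ncard_congr (fun e _ => e.toFinset) ?_ ?_ ?_
  · intro e he
    induction e with
    | _ u v =>
      have huv : G.Adj u v := he
      simp only [Set.mem_ofPred_eq, Sym2.toFinset_mk_eq, SimpleGraph.isNClique_iff,
        Finset.card_pair huv.ne, Finset.coe_insert, Finset.coe_singleton, and_true]
      exact SimpleGraph.isClique_pair.2 fun _ => huv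
  · intro e e' _ _ h
    ext v
    rw [← Sym2.mem_toFinset, ← Sym2.mem_toFinset, show e.toFinset = e'.toFinset from h]
  · rintro s ⟨hs, hcard⟩
    obtain ⟨u, v, huv, rfl⟩ := Finset.card_eq_two.1 hcard
    exact ⟨s(u, v), hs (by simp) (by simp) huv, Sym2.toFinset_mk_eq⟩

lemma cliquePolyOn_union [DecidableEq V] {G : SimpleGraph V} {A B : Finset V}
    (h : ∀ u ∈ A, ∀ v ∈ B, G.Adj u v) :
    cliquePolyOn G (A ∪ B) = cliquePolyOn G A * cliquePolyOn G B := by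
  classical
  have hdisj : Disjoint A B := Finset.disjoint_left.2 fun u hA hB => (h u hA u hB).ne rfl
  rw [cliquePolyOn, cliquePolyOn, cliquePolyOn, Finset.sum_mul_sum, ← Finset.sum_product']
  have hcap : ∀ s ⊆ A, ∀ t ⊆ B, (s ∪ t) ∩ A = s ∧ (s ∪ t) ∩ B = t := by
    intro s hs t ht
    rw [Finset.disjoint_left] at hdisj
    constructor <;> ext v <;> simp only [Finset.mem_inter, Finset.mem_union] <;>
      specialize @hdisj v <;> have h1 := @hs v <;> have h2 := @ht v <;> tauto
  refine Finset.sum_bij' (fun s _ => (s ∩ A, s ∩ B)) (fun p _ => p.1 ∪ p.2) ?_ ?_ ?_ ?_ ?_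
  · intro s hs
    simp only [Finset.mem_filter, Finset.mem_powerset, Finset.mem_product] at hs ⊢
    exact ⟨⟨Finset.inter_subset_right, hs.2.subset (by simp)⟩,
      Finset.inter_subset_right, hs.2.subset (by simp)⟩
  · rintro ⟨s, t⟩ hst
    simp only [Finset.mem_filter, Finset.mem_powerset, Finset.mem_product] at hst ⊢
    obtain ⟨⟨hs, hs'⟩, ht, ht'⟩ := hst
    refine ⟨Finset.union_subset_union hs ht, ?_⟩
    intro u hu v hv huv
    simp only [Finset.coe_union, Set.mem_union, Finset.mem_coe] at hu hv
    rcases hu with hu | hu <;> rcases hv with hv | hv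
    · exact hs' hu hv huv
    · exact h u (hs hu) v (ht hv)
    · exact (h v (hs hv) u (ht hu)).symm
    · exact ht' hu hv huv
  · intro s hs
    simp only [Finset.mem_filter, Finset.mem_powerset] at hs
    simpa [← Finset.inter_union_distrib_left] using hs.1
  · rintro ⟨s, t⟩ hst
    simp only [Finset.mem_filter, Finset.mem_powerset, Finset.mem_product] at hst
    exact Prod.ext (hcap s hst.1.1 t hst.2.1).1 (hcap s hst.1.1 t hst.2.1).2
  · intro s hs
    simp only [Finset.mem_filter, Finset.mem_powerset] at hs
    rw [← pow_add, ← Finset.card_union_of_disjoint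
      (Finset.disjoint_of_subset_left Finset.inter_subset_right
        (Finset.disjoint_of_subset_right Finset.inter_subset_right hdisj)),
      ← Finset.inter_union_distrib_left, Finset.inter_eq_left.2 hs.1]

lemma cliquePolyOn_of_cliqueFreeOn_three {G : SimpleGraph V} {S : Finset V}
    (h : G.CliqueFreeOn S 3) :
    cliquePolyOn G S = 1 + C S.card * X + C ((cliquePolyOn G S).coeff 2) * X ^ 2 := by
  classical
  ext i
  match i with
  | 0 =>
    have : (S.powerset.filter fun s => G.IsNClique 0 s) = {∅} := by
      ext s
      simp +contextual [SimpleGraph.isNClique_zero, Finset.mem_filter]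
    rw [cliquePolyOn_coeff, this]
    simp
  | 1 =>
    have : (S.powerset.filter fun s => G.IsNClique 1 s) = S.image fun v => {v} := by
      ext s
      simp only [SimpleGraph.isNClique_one, Finset.mem_filter, Finset.mem_powerset,
        Finset.mem_image]
      constructor
      · rintro ⟨hs, a, rfl⟩
        exact ⟨a, by simpa using hs, rfl⟩
      · rintro ⟨a, ha, rfl⟩
        exact ⟨by simpa using ha, a, rfl⟩
    rw [cliquePolyOn_coeff, this, Finset.card_image_of_injective _ Finset.singleton_injective]
    simp [coeff_one]
  | 2 => simp [coeff_one]
  | i + 3 =>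
    have : (S.powerset.filter fun s => G.IsNClique (i + 3) s) = ∅ := by
      ext s
      simp only [Finset.mem_filter, Finset.mem_powerset, Finset.notMem_empty, iff_false, not_and]
      exact fun hs => SimpleGraph.CliqueFreeOn.mono G (by omega) h (Finset.coe_subset.2 hs)
    rw [cliquePolyOn_coeff, this]
    simp [coeff_one]

lemma cliquePolyOn_of_independent {G : SimpleGraph V} {S : Finset V}
    (h : ∀ u ∈ S, ∀ v ∈ S, ¬ G.Adj u v) : cliquePolyOn G S = 1 + C S.card * X := by
  classical
  have h2 : G.CliqueFreeOn S 2 := (SimpleGraph.cliqueFreeOn_two G).2 fun u hu v hv _ => h u hu v hv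
  have h0 : (cliquePolyOn G S).coeff 2 = 0 := by
    rw [cliquePolyOn_coeff, Finset.card_eq_zero, Finset.filter_eq_empty_iff]
    exact fun s hs => h2 (by exact_mod_cast Finset.mem_powerset.1 hs)
  rw [cliquePolyOn_of_cliqueFreeOn_three (SimpleGraph.CliqueFreeOn.mono G (by norm_num) h2), h0]
  simp

/-- Mantel's theorem for the subgraph spanned by a set of vertices. -/
lemma four_mul_cliquePolyOn_coeff_two_le {G : SimpleGraph V} {S : Finset V}
    (h : G.CliqueFreeOn S 3) : 4 * (cliquePolyOn G S).coeff 2 ≤ S.card ^ 2 := by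
  classical
  have hfree : (G.induce (S : Set V)).CliqueFree (2 + 1) :=
    (SimpleGraph.cliqueFree_induce_iff G S 3).2 h
  have hle := hfree.card_edgeFinset_le
  have hcard : (G.induce (S : Set V)).edgeFinset.card = (cliquePolyOn G S).coeff 2 := by
    rw [SimpleGraph.edgeFinset, ← Set.ncard_eq_toFinset_card']
    change edgeCnt _ = _
    rw [← NK_two, NK, cliquePolyOn_coeff, ← Set.ncard_coe_finset]
    refine Set.ncard_congr (fun s _ => s.map (Function.Embedding.subtype _)) ?_ ?_ ?_
    · intro s hs
      have := (SimpleGraph.isNClique_induce_iff _ _ _).1 hs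
      simp only [Finset.coe_filter, Finset.mem_powerset, Set.mem_ofPred_eq]
      refine ⟨fun v hv => ?_, this⟩
      obtain ⟨w, -, rfl⟩ := Finset.mem_map.1 hv
      exact w.2
    · intro s t _ _ hst
      exact Finset.map_injective _ hst
    · intro s hs
      simp only [Finset.coe_filter, Finset.mem_powerset, Set.mem_ofPred_eq] at hs
      have hsub : (s.subtype (· ∈ (S : Set V))).map (Function.Embedding.subtype _) = s := by
        rw [Finset.subtype_map, Finset.filter_eq_self]
        exact fun v hv => hs.1 hv
      exact ⟨s.subtype (· ∈ (S : Set V)),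
        (SimpleGraph.isNClique_induce_iff _ _ _).2 (by rw [hsub]; exact hs.2), hsub⟩
  rw [hcard] at hle
  simp only [Fintype.card_coe, SetLike.coe_sort_coe] at hle
  generalize S.card = b at *
  generalize (cliquePolyOn G S).coeff 2 = t at *
  rcases Nat.mod_two_eq_zero_or_one b with hb | hb <;> rw [hb] at hle <;>
    norm_num [Nat.choose] at hle
  · omega
  · have := Nat.one_le_pow 2 b (by omega)
    omega

open Classical in
/-- The clique polynomial of a complete multipartite graph with a triangle-free graph added into
the part of colour `j₀`. -/
lemma cliquePolyOn_univ_eq_joinPoly [Fintype V] {G : SimpleGraph V} {c : V → ℕ} {j₀ : ℕ}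
    (h1 : ∀ u v, c u ≠ c v → G.Adj u v) (h2 : ∀ u v, G.Adj u v → c u = c v → c u = j₀)
    (h3 : G.CliqueFreeOn {v | c v = j₀} 3) {T : Finset ℕ} (hj : j₀ ∉ T)
    (hT : ∀ v, c v = j₀ ∨ c v ∈ T) :
    cliquePolyOn G Finset.univ =
      joinPoly (T.val.map fun j => (Finset.univ.filter fun v => c v = j).card)
        (Finset.univ.filter fun v => c v = j₀).card
        ((cliquePolyOn G (Finset.univ.filter fun v => c v = j₀)).coeff 2) := by
  have key : ∀ T : Finset ℕ, j₀ ∉ T →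
      cliquePolyOn G (Finset.univ.filter fun v => c v = j₀ ∨ c v ∈ T) =
        cliquePolyOn G (Finset.univ.filter fun v => c v = j₀) *
          partPoly (T.val.map fun j => (Finset.univ.filter fun v => c v = j).card) := by
    intro T
    induction T using Finset.induction_on with
    | empty => simp [partPoly]
    | insert j T hjT ih =>
      intro hj
      simp only [Finset.mem_insert, not_or] at hj
      have hunion : (Finset.univ.filter fun v => c v = j₀ ∨ c v ∈ insert j T) =
          (Finset.univ.filter fun v => c v = j) ∪
            (Finset.univ.filter fun v => c v = j₀ ∨ c v ∈ T) := by
        ext v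
        simp only [Finset.mem_insert, Finset.mem_filter, Finset.mem_univ, true_and,
          Finset.mem_union]
        tauto
      rw [hunion, cliquePolyOn_union, ih hj.2, Finset.insert_val_of_notMem hjT, Multiset.map_cons,
        partPoly_cons, cliquePolyOn_of_independent]
      · ring
      · intro u hu v hv huv
        simp only [Finset.mem_filter, Finset.mem_univ, true_and] at hu hv
        exact hj.1 ((h2 u v huv (hu.trans hv.symm)).symm.trans hu)
      · intro u hu v hv
        simp only [Finset.mem_filter, Finset.mem_univ, true_and] at hu hv
        refine h1 u v fun huv => ?_
        rw [← huv, hu] at hv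
        rcases hv with hv | hv
        · exact hj.1 hv.symm
        · exact hjT hv
  have := key T hj
  rw [Finset.filter_true_of_mem fun v _ => hT v] at this
  rw [this, joinPoly]
  congr 1
  exact cliquePolyOn_of_cliqueFreeOn_three (by simpa using h3)

end CliquePoly

lemma exists_joinPoly_of_memK {n e : ℕ} {G : SimpleGraph (Fin n)} (hG : MemK n e G) :
    ∃ (Z : Multiset ℕ) (b t : ℕ), 4 * t ≤ b ^ 2 ∧ (joinPoly Z b t).coeff 1 = n ∧
      ∀ r, NK G r = (joinPoly Z b t).coeff r := by
  classical
  obtain ⟨-, c, j₀, h1, h2, h3⟩ := hG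
  rw [SimpleGraph.cliqueFree_induce_iff] at h3
  have hpoly := cliquePolyOn_univ_eq_joinPoly h1 h2 h3
    (T := (Finset.univ.image c).erase j₀) (by simp)
    (fun v => by by_cases h : c v = j₀ <;> simp [h])
  refine ⟨((Finset.univ.image c).erase j₀).val.map fun j =>
      (Finset.univ.filter fun v => c v = j).card, _, _, four_mul_cliquePolyOn_coeff_two_le (S := Finset.univ.filter fun v => c v = j₀)
    (by simpa using h3), ?_, fun r => ?_⟩
  rotate_left
  · rw [NK_eq_coeff, hpoly]
  · rw [← hpoly, ← NK_eq_coeff, NK]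
    have : {s | G.IsNClique 1 s} = Set.range fun v : Fin n => {v} := by
      ext s
      simp [SimpleGraph.isNClique_one, eq_comm]
    rw [this, ← Set.image_univ, Set.ncard_image_of_injective _ Finset.singleton_injective]
    simp

open Classical in
lemma exists_coloring_with_fiber_card {p : ℕ} (sz : Fin p → ℕ) {n : ℕ} (hn : ∑ i, sz i = n) :
    ∃ c : Fin n → Fin p, ∀ i, (Finset.univ.filter fun v => c v = i).card = sz i := by
  subst hn
  refine ⟨fun v => (finSigmaFinEquiv.symm v).1, fun i => ?_⟩
  have : (Finset.univ.filter fun v => (finSigmaFinEquiv (n := sz).symm v).1 = i) =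
      (Finset.univ : Finset (Fin (sz i))).image fun x => finSigmaFinEquiv ⟨i, x⟩ := by
    ext v
    obtain ⟨⟨j, x⟩, rfl⟩ := finSigmaFinEquiv.surjective v
    simp only [Equiv.symm_apply_apply, Finset.mem_filter, Finset.mem_univ, true_and,
      Finset.mem_image, EmbeddingLike.apply_eq_iff_eq]
    constructor
    · rintro rfl
      exact ⟨x, rfl⟩
    · rintro ⟨y, hy⟩
      exact (congrArg Sigma.fst hy).symm
  rw [this, Finset.card_image_of_injective, Finset.card_univ, Fintype.card_fin]
  intro x y hxy
  simpa using hxy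

/-- Every admissible join is realized by a member of the family `K(n,e)`. -/
lemma exists_memK_of_joinPoly {Z : Multiset ℕ} {b t n : ℕ} (hbt : 4 * t ≤ b ^ 2)
    (hn : (joinPoly Z b t).coeff 1 = n) :
    ∃ G : SimpleGraph (Fin n), MemK n ((joinPoly Z b t).coeff 2) G ∧
      ∀ r, NK G r = (joinPoly Z b t).coeff r := by
  classical
  rw [joinPoly_coeff_one] at hn
  obtain ⟨l, rfl⟩ := Quotient.exists_rep Z
  change ((l : Multiset ℕ)).sum + b = n at hn
  change ∃ G : SimpleGraph (Fin n), MemK n ((joinPoly (l : Multiset ℕ) b t).coeff 2) G ∧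
      ∀ r, NK G r = (joinPoly (l : Multiset ℕ) b t).coeff r
  rw [Multiset.sum_coe] at hn
  obtain ⟨c, hc⟩ := exists_coloring_with_fiber_card (Fin.cons b l.get : Fin (l.length + 1) → ℕ)
    (n := n) (by rw [Fin.sum_univ_succ]; simp only [Fin.cons_zero, Fin.cons_succ];
                 rw [← hn, add_comm, ← List.sum_ofFn, List.ofFn_get])
  set F := Finset.univ.filter fun v => c v = 0 with hF
  have hFb : F.card = b := by simpa using hc 0
  obtain ⟨A, hAF, hA⟩ := Finset.exists_subset_card_eq (s := F) (n := b / 2) (by omega)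
  obtain ⟨E, hE, hEt⟩ := Finset.exists_subset_card_eq (s := A ×ˢ (F \ A)) (n := t) (by
    rw [Finset.card_product, Finset.card_sdiff_of_subset hAF, hFb, hA]
    obtain ⟨d, rfl | rfl⟩ := b.even_or_odd'
    · rw [show 2 * d / 2 = d by omega, show 2 * d - d = d by omega]; nlinarith
    · rw [show (2 * d + 1) / 2 = d by omega, show 2 * d + 1 - d = d + 1 by omega]; nlinarith)
  have hEmem : ∀ u v, (u, v) ∈ E → u ∈ A ∧ v ∉ A ∧ c u = 0 ∧ c v = 0 := by
    intro u v huv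
    have := hE huv
    simp only [Finset.mem_product, Finset.mem_sdiff] at this
    exact ⟨this.1, this.2.2, by simpa [hF] using hAF this.1, by simpa [hF] using this.2.1⟩
  let G : SimpleGraph (Fin n) :=
    { Adj := fun u v => c u ≠ c v ∨ (u, v) ∈ E ∨ (v, u) ∈ E
      symm := ⟨fun u v h => by tauto⟩
      loopless := ⟨fun u h => by
        rcases h with h | h | h
        · exact h rfl
        · exact (hEmem u u h).2.1 (hEmem u u h).1
        · exact (hEmem u u h).2.1 (hEmem u u h).1⟩ }
  have hadj : ∀ u v, c u = 0 → c v = 0 → G.Adj u v → ((u, v) ∈ E ∨ (v, u) ∈ E) := by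
    intro u v hu hv h
    rcases h with h | h
    · exact absurd (hu.trans hv.symm) h
    · exact h
  have h1 : ∀ u v, (c u : ℕ) ≠ c v → G.Adj u v := fun u v h => Or.inl fun h' => h (by rw [h'])
  have h2 : ∀ u v, G.Adj u v → (c u : ℕ) = c v → (c u : ℕ) = 0 := by
    intro u v h huv
    rcases h with h | h | h
    · exact absurd (Fin.ext huv) h
    · simp [(hEmem _ _ h).2.2.1]
    · simp [(hEmem _ _ h).2.2.2]
  have h3 : G.CliqueFreeOn {v | (c v : ℕ) = 0} 3 := by
    intro s hs hs3
    obtain ⟨u, v, w, huv, huw, hvw, rfl⟩ := SimpleGraph.is3Clique_iff.1 hs3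
    simp only [Finset.coe_insert, Finset.coe_singleton, Set.insert_subset_iff, Set.mem_ofPred_eq,
      Fin.val_eq_zero_iff, Set.singleton_subset_iff] at hs
    obtain ⟨hu, hv, hw⟩ := hs
    rcases hadj u v hu hv huv with a1 | a1 <;> rcases hadj u w hu hw huw with a2 | a2 <;>
      rcases hadj v w hv hw hvw with a3 | a3 <;>
      have b1 := hEmem _ _ a1 <;> have b2 := hEmem _ _ a2 <;> have b3 := hEmem _ _ a3 <;> tauto
  have hcoeff : (cliquePolyOn G F).coeff 2 = t := by
    rw [cliquePolyOn_coeff, ← hEt]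
    symm
    refine Finset.card_bij (fun p _ => {p.1, p.2}) ?_ ?_ ?_
    · rintro ⟨u, v⟩ huv
      have hm := hEmem _ _ huv
      have hG : G.Adj u v := Or.inr (Or.inl huv)
      simp only [Finset.mem_filter, Finset.mem_powerset, SimpleGraph.isNClique_iff,
        Finset.card_pair hG.ne, and_true]
      refine ⟨by simp [Finset.insert_subset_iff, hF, hm], ?_⟩
      rw [Finset.coe_pair]
      exact SimpleGraph.isClique_pair.2 fun _ => hG
    · rintro ⟨u, v⟩ huv ⟨u', v'⟩ huv' h
      have hm := hEmem _ _ huv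
      have hm' := hEmem _ _ huv'
      have hu : u ∈ ({u', v'} : Finset (Fin n)) := by rw [← h]; simp
      have hv : v ∈ ({u', v'} : Finset (Fin n)) := by rw [← h]; simp
      simp only [Finset.mem_insert, Finset.mem_singleton] at hu hv
      rcases hu with rfl | rfl
      · rcases hv with rfl | rfl
        · exact absurd hm.1 hm.2.1
        · rfl
      · exact absurd hm.1 hm'.2.1
    · intro s hs
      simp only [Finset.mem_filter, Finset.mem_powerset, SimpleGraph.isNClique_iff] at hs
      obtain ⟨hsF, hcl, hcard⟩ := hs
      obtain ⟨u, v, huv, rfl⟩ := Finset.card_eq_two.1 hcard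
      simp only [Finset.insert_subset_iff, Finset.singleton_subset_iff, hF, Finset.mem_filter,
        Finset.mem_univ, true_and] at hsF
      rcases hadj u v hsF.1 hsF.2 (hcl (by simp) (by simp) huv) with h | h
      · exact ⟨(u, v), h, rfl⟩
      · exact ⟨(v, u), h, Finset.pair_comm _ _⟩
  have hpoly := cliquePolyOn_univ_eq_joinPoly (c := fun v => (c v : ℕ)) h1 h2 h3
    (T := (Finset.range l.length).image Nat.succ) (by simp) (fun v => by
      rcases Fin.eq_zero_or_eq_succ (c v) with h | ⟨j, h⟩
      · simp [h]
      · right; simp [h])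
  have hfib0 : (Finset.univ.filter fun v => (c v : ℕ) = 0) = F := by
    ext v; simp [hF]
  have hparts : (((Finset.range l.length).image Nat.succ).val.map fun j =>
      (Finset.univ.filter fun v => (c v : ℕ) = j).card) = (l : Multiset ℕ) := by
    rw [Finset.image_val_of_injOn Nat.succ_injective.injOn, Multiset.map_map, Finset.range_val,
      Multiset.range, Multiset.map_coe, Multiset.coe_eq_coe]
    refine List.Perm.of_eq (List.ext_getElem (by simp) fun i hi hi' => ?_)
    simp only [List.getElem_map, List.getElem_range, Function.comp]
    have := hc (Fin.succ ⟨i, hi'⟩)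
    simp only [Fin.cons_succ, List.get_eq_getElem] at this
    rw [← this]
    congr 1
    ext v
    simp [Fin.ext_iff]
  rw [hfib0, hcoeff, hFb, hparts] at hpoly
  have hNK : ∀ r, NK G r = (joinPoly (l : Multiset ℕ) b t).coeff r := fun r => by
    rw [NK_eq_coeff, hpoly]
  exact ⟨G, ⟨by rw [← NK_two, hNK], fun v => c v, 0, h1, h2,
    (SimpleGraph.cliqueFree_induce_iff _ _ _).2 h3⟩, hNK⟩

section TuranNumber

lemma tur_eq_card_edgeFinset (s n : ℕ) :
    tur s n = (SimpleGraph.turanGraph n s).edgeFinset.card := by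
  rw [tur, edgeCnt, Set.ncard_eq_toFinset_card', SimpleGraph.edgeFinset]

lemma tur_add (s n : ℕ) : tur s (n + s) = tur s n + n * (s - 1) + s.choose 2 := by
  simp only [tur_eq_card_edgeFinset, SimpleGraph.card_edgeFinset_turanGraph_add]

lemma tur_of_le {s n : ℕ} (h : n ≤ s) : tur s n = n.choose 2 := by
  rw [tur, SimpleGraph.turanGraph_eq_top.2 (Or.inr h), edgeCnt, Set.ncard_eq_toFinset_card',
    ← SimpleGraph.edgeFinset, SimpleGraph.card_edgeFinset_top_eq_card_choose_two, Fintype.card_fin]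

lemma tur_succ {s : ℕ} (hs : 0 < s) (n : ℕ) : tur s (n + 1) = tur s n + (n - n / s) := by
  induction n using Nat.strong_induction_on with
  | _ n ih =>
    rcases lt_or_ge n s with h | h
    · rw [tur_of_le h, tur_of_le h.le, Nat.div_eq_of_lt h, Nat.choose_succ_succ' n 1,
        Nat.choose_one_right, Nat.sub_zero, add_comm]
    · obtain ⟨n, rfl⟩ := Nat.exists_eq_add_of_le' h
      have hdiv : n / s ≤ n := Nat.div_le_self n s
      obtain ⟨s, rfl⟩ := Nat.exists_eq_add_of_le' hs
      rw [show n + (s + 1) + 1 = n + 1 + (s + 1) by ring, tur_add, tur_add, ih n (by omega),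
        Nat.add_div_right _ hs, Nat.add_sub_cancel, add_mul]
      omega

lemma tur_mono_left {s s' : ℕ} (hs : 0 < s) (h : s ≤ s') (n : ℕ) : tur s n ≤ tur s' n := by
  induction n with
  | zero => rw [tur_of_le (Nat.zero_le _), tur_of_le (Nat.zero_le _)]
  | succ n ih =>
    rw [tur_succ hs, tur_succ (hs.trans_le h)]
    have : n / s' ≤ n / s := Nat.div_le_div_left h hs
    omega

lemma two_mul_tur_add (q w x : ℕ) :
    2 * tur (q + w) ((q + w) * x + q) + (q * (x + 1) ^ 2 + w * x ^ 2) =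
      ((q + w) * x + q) ^ 2 := by
  have hchoose : ∀ k : ℕ, 2 * k.choose 2 + k = k ^ 2 := fun k => by
    induction k with
    | zero => rfl
    | succ k ih =>
      rw [Nat.choose_succ_succ' k 1, Nat.choose_one_right]
      linarith
  induction x with
  | zero =>
    rw [mul_zero, zero_add, tur_of_le (Nat.le_add_right q w)]
    simpa using hchoose q
  | succ x ih =>
    rcases Nat.eq_zero_or_pos (q + w) with h | h
    · obtain ⟨rfl, rfl⟩ : q = 0 ∧ w = 0 := by omega
      simp [tur_of_le]
    · have h2 := hchoose (q + w)
      rw [show (q + w) * (x + 1) + q = (q + w) * x + q + (q + w) by ring, tur_add]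
      obtain ⟨d, hd⟩ := Nat.exists_eq_add_of_le' h
      have hd' : q + w - 1 = d := by omega
      rw [hd']
      have hq : (q : ℤ) = d + 1 - w := by omega
      zify at *
      rw [hq] at *
      simp only [sub_add_cancel] at *
      linarith

/-- **Turán's theorem** in terms of `tur`. -/
lemma edgeCnt_le_tur {n s : ℕ} {G : SimpleGraph (Fin n)} (h : G.CliqueFree (s + 1)) :
    edgeCnt G ≤ tur s n := by
  classical
  have := h.card_edgeFinset_le
  rw [tur_eq_card_edgeFinset, SimpleGraph.card_edgeFinset_turanGraph, edgeCnt,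
    Set.ncard_eq_toFinset_card', ← SimpleGraph.edgeFinset]
  simpa using this

end TuranNumber

section BalancedParameters

open Polynomial

lemma exists_eq_replicate_add_replicate {Z : Multiset ℕ} {x : ℕ}
    (h : ∀ z ∈ Z, z = x ∨ z = x + 1) :
    ∃ q w, Z = Multiset.replicate q (x + 1) + Multiset.replicate w x := by
  induction Z using Multiset.induction_on with
  | empty => exact ⟨0, 0, by simp⟩
  | cons z Z ih =>
    obtain ⟨q, w, rfl⟩ := ih fun y hy => h y (Multiset.mem_cons_of_mem hy)
    rcases h z (Multiset.mem_cons_self _ _) with rfl | rfl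
    · exact ⟨q, w + 1, by rw [Multiset.replicate_succ, Multiset.add_cons]⟩
    · exact ⟨q + 1, w, by rw [Multiset.replicate_succ, Multiset.cons_add]⟩

lemma partPoly_coeff_eq_sum_powersetCard {ι : Type*} (S : Finset ι) (f : ι → ℕ) (r : ℕ) :
    (partPoly (S.val.map f)).coeff r = ∑ I ∈ S.powersetCard r, ∏ i ∈ I, f i := by
  classical
  rw [partPoly, Multiset.map_map]
  change (∏ i ∈ S, (1 + C (f i) * X)).coeff r = _
  rw [Finset.prod_one_add, finsetSum_coeff, Finset.powersetCard_eq_filter, Finset.sum_filter]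
  refine Finset.sum_congr rfl fun I _ => ?_
  rw [Finset.prod_mul_distrib, Finset.prod_const, ← map_prod, coeff_C_mul_X_pow]
  simp only [eq_comm]

/-- Thickening the triangle-free part of a join to a complete bipartite graph. -/
lemma partPoly_cons_cons_coeff {Z : Multiset ℕ} {x a m t r : ℕ} (hxa : x * a = t + m)
    (hr : 2 ≤ r) :
    (partPoly (a ::ₘ x ::ₘ Z)).coeff r =
      (joinPoly Z (x + a) t).coeff r + m * (partPoly Z).coeff (r - 2) := by
  have : partPoly (a ::ₘ x ::ₘ Z) = joinPoly Z (x + a) t + C m * (X ^ 2 * partPoly Z) := by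
    have hC : (C x * C a : ℕ[X]) = C t + C m := by rw [← C_mul, hxa, C_add]
    rw [partPoly_cons, partPoly_cons, joinPoly, C_add]
    calc (1 + C a * X) * ((1 + C x * X) * partPoly Z)
        = (1 + (C x + C a) * X) * partPoly Z + C x * C a * (X ^ 2 * partPoly Z) := by ring
      _ = _ := by rw [hC]; ring
  rw [this, coeff_add, coeff_C_mul, coeff_X_pow_mul', if_pos hr]

lemma Icc_map_eq_replicate_add_replicate {g : ℕ → ℕ} {q w x : ℕ}
    (hg : ∀ i, 1 ≤ i → i ≤ q + w → g i = x + if i ≤ q then 1 else 0) :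
    (Finset.Icc 1 (q + w)).val.map g =
      Multiset.replicate q (x + 1) + Multiset.replicate w x := by
  induction w with
  | zero =>
    rw [Multiset.replicate_zero, add_zero, add_zero, Multiset.eq_replicate]
    refine ⟨by simp, fun b hb => ?_⟩
    simp only [Multiset.mem_map, Finset.mem_val, Finset.mem_Icc] at hb
    obtain ⟨i, hi, rfl⟩ := hb
    rw [hg i hi.1 (by omega), if_pos hi.2]
  | succ w ih =>
    rw [← add_assoc, ← Finset.insert_Icc_right_eq_Icc_add_one (by omega),
      Finset.insert_val_of_notMem (by simp), Multiset.map_cons,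
      ih fun i h1 h2 => hg i h1 (by omega), hg (q + w + 1) (by omega) (by omega),
      if_neg (by omega), Multiset.replicate_succ, Multiset.add_cons, add_zero]

/-- The numerical parameters of a nearly balanced join are `k(n,e)` and `a_k*(n,e)`. -/
lemma kk_eq_and_aLast_eq {q w x a m t n e : ℕ} (ha : 1 ≤ a) (hxa : x * a = t + m) (hm : m + a ≤ x)
    (hn : n = (q + w + 1) * x + q + a)
    (he : (joinPoly (Multiset.replicate q (x + 1) + Multiset.replicate w x) (x + a) t).coeff 2 = e) :
    kk n e = q + w + 2 ∧ aLast n e = a := by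
  set Z := Multiset.replicate q (x + 1) + Multiset.replicate w x with hZ
  have hsum : Z.sum = (q + w) * x + q := by
    simp only [hZ, Multiset.sum_add, Multiset.sum_replicate, smul_eq_mul]; ring
  have hcard : Z.card = q + w := by simp [hZ]
  have hupper : e ≤ tur (q + w + 2) n := by
    obtain ⟨G, hG, hNK⟩ := exists_memK_of_joinPoly (Z := Z) (b := x + a) (t := t) (n := n)
      (by zify at *; nlinarith [sq_nonneg ((x : ℤ) - a)])
      (by rw [joinPoly_coeff_one, hsum, hn]; ring)
    rw [← he, ← hG.1]
    refine edgeCnt_le_tur fun s hs => ?_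
    have h0 : NK G (q + w + 2 + 1) = 0 := by
      rw [hNK]
      refine coeff_eq_zero_of_natDegree_lt ((joinPoly_natDegree_le _ _ _).trans_lt ?_)
      omega
    rw [NK, Set.ncard_eq_zero] at h0
    exact Set.eq_empty_iff_forall_notMem.1 h0 s hs
  let f : ℕ → ℕ := fun j => j * (n - j) + tur (q + w + 1) (n - j)
  have hstep : ∀ j < a, f (j + 1) + j = f j + (n - (j + 1)) / (q + w + 1) := by
    intro j hj
    obtain ⟨N, hN⟩ : ∃ N, n = N + (j + 1) := Nat.exists_eq_add_of_le' (by omega)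
    have h1 : n - (j + 1) = N := by omega
    have h2 : n - j = N + 1 := by omega
    have h3 := Nat.div_le_self N (q + w + 1)
    simp only [f]
    rw [h1, h2, tur_succ (by omega)]
    zify [h3]
    ring
  have hdiv : (n - a) / (q + w + 1) = x := by
    rw [hn, Nat.add_sub_cancel, Nat.mul_add_div (by omega), Nat.div_eq_of_lt (by omega), add_zero]
  have hmono : ∀ j < a, f j ≤ f (j + 1) := by
    intro j hj
    have h1 : (n - a) / (q + w + 1) ≤ (n - (j + 1)) / (q + w + 1) :=
      Nat.div_le_div_right (by omega)
    have := hstep j hj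
    omega
  have hfa : f a = e + m := by
    have h1 := two_mul_partPoly_coeff_two Z
    have h2 := two_mul_tur_add q (w + 1) x
    have h3 : (Z.map fun z => z ^ 2).sum = q * (x + 1) ^ 2 + w * x ^ 2 := by
      simp [hZ]
    rw [joinPoly_coeff_two] at he
    simp only [f]
    rw [h3, hsum] at h1
    rw [hsum] at he
    rw [hn, Nat.add_sub_cancel, ← he]
    rw [← add_assoc] at h2
    generalize (partPoly Z).coeff 2 = c at h1 ⊢
    generalize tur (q + w + 1) ((q + w + 1) * x + q) = T at h2 ⊢
    clear hstep hdiv hmono f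
    have hT : 2 * T = 2 * (c + x * ((q + w) * x + q)) := by linarith
    have hT' : T = c + x * ((q + w) * x + q) := by omega
    rw [hT', add_assoc _ t m, ← hxa]
    ring
  have hlt : ∀ j < a, f j < e := by
    have hpred : f (a - 1) < e := by
      have := hstep (a - 1) (by omega)
      rw [Nat.sub_add_cancel ha, hdiv, hfa] at this
      omega
    have hdown : ∀ d, d + 1 ≤ a → f (a - (d + 1)) < e := by
      intro d
      induction d with
      | zero => intro _; exact hpred
      | succ d ih =>
        intro hd
        have := hmono (a - (d + 1 + 1)) (by omega)
        rw [show a - (d + 1 + 1) + 1 = a - (d + 1) by omega] at this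
        exact this.trans_lt (ih (by omega))
    intro j hj
    have := hdown (a - 1 - j) (by omega)
    rwa [show a - (a - 1 - j + 1) = j by omega] at this
  have hkk : kk n e = q + w + 2 := by
    refine IsLeast.csInf_eq ⟨⟨by omega, hupper⟩, ?_⟩
    rintro s ⟨hs, hes⟩
    by_contra hcon
    have h0 := hlt 0 (by omega)
    simp only [f, zero_mul, zero_add, Nat.sub_zero] at h0
    exact absurd (hes.trans (tur_mono_left hs (by omega) n)) (not_le.2 h0)
  refine ⟨hkk, IsLeast.csInf_eq ⟨⟨ha, ?_⟩, ?_⟩⟩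
  · rw [hkk, show q + w + 2 - 1 = q + w + 1 by omega]
    change e ≤ f a
    omega
  · rintro j ⟨-, hj⟩
    rw [hkk, show q + w + 2 - 1 = q + w + 1 by omega] at hj
    by_contra hcon
    exact absurd hj (not_le.2 (hlt j (by omega)))

/-- The clique numbers of a nearly balanced join are given by `h_r*(n,e)`. -/
lemma hStar_eq_joinPoly_coeff {Z : Multiset ℕ} {x a m t n e r : ℕ} (ha : 1 ≤ a)
    (hxa : x * a = t + m) (hm : m + a ≤ x) (hZ : ∀ z ∈ Z, z = x ∨ z = x + 1)
    (hn : (joinPoly Z (x + a) t).coeff 1 = n) (he : (joinPoly Z (x + a) t).coeff 2 = e)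
    (hr : 2 ≤ r) : hStar n e r = (joinPoly Z (x + a) t).coeff r := by
  obtain ⟨q, w, rfl⟩ := exists_eq_replicate_add_replicate hZ
  have hn' : n = (q + w + 1) * x + q + a := by
    rw [joinPoly_coeff_one] at hn
    simp only [Multiset.sum_add, Multiset.sum_replicate, smul_eq_mul] at hn
    rw [← hn]; ring
  obtain ⟨hkk, haL⟩ := kk_eq_and_aLast_eq ha hxa hm hn' he
  have hlast : aStar n e (q + w + 2) = a := by rw [aStar, if_pos hkk.symm, haL]
  have hsmall : ∀ i, 1 ≤ i → i ≤ q + (w + 1) → aStar n e i = x + if i ≤ q then 1 else 0 := by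
    intro i _ hi
    have hna : n - a = (q + w + 1) * x + q := by omega
    rw [aStar, if_neg (by omega), hkk, haL, hna, show q + w + 2 - 1 = q + w + 1 by omega,
      Nat.mul_add_div (by omega), Nat.div_eq_of_lt (by omega), Nat.mul_add_mod,
      Nat.mod_eq_of_lt (by omega), add_zero]
  have hparts := Icc_map_eq_replicate_add_replicate hsmall
  have hall : (Finset.Icc 1 (q + w + 2)).val.map (aStar n e) =
      a ::ₘ x ::ₘ (Multiset.replicate q (x + 1) + Multiset.replicate w x) := by
    rw [show q + w + 2 = q + (w + 1) + 1 by ring] at hlast ⊢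
    rw [← Finset.insert_Icc_right_eq_Icc_add_one (by omega),
      Finset.insert_val_of_notMem (by simp), Multiset.map_cons, hlast, hparts,
      Multiset.replicate_succ, Multiset.add_cons]
  have hfew : (Finset.Icc 1 (q + w)).val.map (aStar n e) =
      Multiset.replicate q (x + 1) + Multiset.replicate w x :=
    Icc_map_eq_replicate_add_replicate fun i h1 h2 => hsmall i h1 (by omega)
  have hmStar : mStar n e = m := by
    rw [mStar, hkk, ← partPoly_coeff_eq_sum_powersetCard, hall,
      partPoly_cons_cons_coeff hxa le_rfl, he, Nat.sub_self, partPoly_coeff_zero]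
    omega
  have h1 := partPoly_coeff_eq_sum_powersetCard (Finset.Icc 1 (q + w + 2)) (aStar n e) r
  have h2 := partPoly_coeff_eq_sum_powersetCard (Finset.Icc 1 (q + w)) (aStar n e) (r - 2)
  rw [hall, partPoly_cons_cons_coeff hxa hr] at h1
  rw [hfew] at h2
  rw [hStar, hmStar, hkk, Nat.add_sub_cancel]
  zify at h1 h2
  rw [← h1, ← h2]
  ring

end BalancedParameters

/-- For `n ≥ r ≥ 3` and `1 ≤ e ≤ C(n,2)`, the minimum of `N(K_r, G)`
over all `G ∈ K(n,e)` equals `h_r*(n,e)`. -/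
theorem erdos_rademacher_min_over_K (n e r : ℕ) (hrn : r ≤ n) (hr : 3 ≤ r)
    (he1 : 1 ≤ e) (he2 : e ≤ n.choose 2) :
    IsLeast {x : ℤ | ∃ G : SimpleGraph (Fin n), MemK n e G ∧ (NK G r : ℤ) = x}
      (hStar n e r) := by

  obtain ⟨Z, b, t, hbt, h1, h2⟩ := exists_joinPoly n e he2
  obtain ⟨Z', x, a, m, t', ha, hxa, hm, hZ', hlow, -⟩ :=
    exists_balanced_joinPoly Z b t hbt (by omega)
  have hn : (joinPoly Z' (x + a) t').coeff 1 = n := (hlow 1 (by norm_num)).trans h1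
  have he : (joinPoly Z' (x + a) t').coeff 2 = e := (hlow 2 (by norm_num)).trans h2
  refine ⟨?_, ?_⟩
  · obtain ⟨G, hG, hNK⟩ := exists_memK_of_joinPoly (Z := Z') (b := x + a) (t := t') (n := n)
      (by zify at *; nlinarith [sq_nonneg ((x : ℤ) - a)]) hn
    rw [he] at hG
    exact ⟨G, hG, by rw [hNK, hStar_eq_joinPoly_coeff ha hxa hm hZ' hn he (by omega)]⟩
  · rintro _ ⟨G, hG, rfl⟩
    obtain ⟨Z, b, t, hbt, h1, hNK⟩ := exists_joinPoly_of_memK hG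
    have h2 : (joinPoly Z b t).coeff 2 = e := by rw [← hNK, NK_two, hG.1]
    obtain ⟨Z', x, a, m, t', ha, hxa, hm, hZ', hlow, hle⟩ :=
      exists_balanced_joinPoly Z b t hbt (by omega)
    rw [hNK, hStar_eq_joinPoly_coeff ha hxa hm hZ' ((hlow 1 (by norm_num)).trans h1)
      ((hlow 2 (by norm_num)).trans h2) (by omega)]
    exact_mod_cast hle r
end

section
/- Let r ≥ 3 and ℓ ≥ 2 be integers, and let G be a finite graph whose vertex set is partitioned into nonempty parts V_1, ..., V_ℓ such that G contains every edge between distinct parts and each induced subgraph G[V_i] is triangle-free. Let S := V_1 ∪ V_2 and S̄ := V(G) \ S. Then N(K_r, G) = e(G[V_1]) · e(G[V_2]) · N(K_{r−4}, G[S̄]) + (e(G[V_1]) · |V_2| + e(G[V_2]) · |V_1|) · N(K_{r−3}, G[S̄]) + e(G[S]) · N(K_{r−2}, G[S̄]) + |S| · N(K_{r−1}, G[S̄]) + N(K_r, G[S̄]), with the conventions N(K_0, H) = 1 and N(K_{−1}, H) = 0 for every graph H. -/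
/-- The `n`-cliques of `G` all of whose vertices lie in `A`. -/
def cliquesOn {V : Type*} (G : SimpleGraph V) (A : Set V) (n : ℕ) : Set (Finset V) :=
  {s | G.IsNClique n s ∧ (s : Set V) ⊆ A}

theorem NK_induce {V : Type*} (G : SimpleGraph V) (A : Set V) (n : ℕ) :
    NK (G.induce A) n = (cliquesOn G A n).ncard := by
  classical
  have h : cliquesOn G A n =
      Finset.map (Function.Embedding.subtype (· ∈ A)) '' {s | (G.induce A).IsNClique n s} := by
    ext s
    constructor
    · rintro ⟨hs, hA⟩
      have hmap : (s.subtype (· ∈ A)).map (Function.Embedding.subtype _) = s :=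
        Finset.subtype_map_of_mem fun x hx => hA hx
      refine ⟨s.subtype (· ∈ A), ?_, hmap⟩
      rw [Set.mem_ofPred_eq, SimpleGraph.isNClique_induce_iff]
      exact hmap.symm ▸ hs
    · rintro ⟨t, ht, rfl⟩
      refine ⟨(SimpleGraph.isNClique_induce_iff A t n).1 ht, ?_⟩
      intro x hx
      simp only [Finset.coe_map, Set.mem_image] at hx
      obtain ⟨y, -, rfl⟩ := hx
      exact y.2
  rw [h, Set.ncard_image_of_injective _ (Finset.map_injective _)]
  rfl

theorem edgeCnt_eq_NK_two {V : Type*} (G : SimpleGraph V) : edgeCnt G = NK G 2 := by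
  classical
  refine Set.ncard_congr (fun e _ => e.toFinset) ?_ ?_ ?_
  · intro e he
    induction e with | _ x y
    have hxy : G.Adj x y := he
    rw [Sym2.toFinset_mk_eq, Set.mem_ofPred_eq, SimpleGraph.isNClique_iff]
    exact ⟨by simp [hxy], Finset.card_pair hxy.ne⟩
  · intro e f _ _ h
    ext x
    rw [← Sym2.mem_toFinset, ← Sym2.mem_toFinset]
    exact iff_of_eq (congrArg (x ∈ ·) h)
  · intro s hs
    obtain ⟨x, y, hxy, rfl⟩ := Finset.card_eq_two.1 hs.card_eq
    refine ⟨s(x, y), hs.isClique (by simp) (by simp) hxy, Sym2.toFinset_mk_eq⟩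

theorem ncard_cliquesOn_zero {V : Type*} (G : SimpleGraph V) (A : Set V) :
    (cliquesOn G A 0).ncard = 1 := by
  have h : cliquesOn G A 0 = {∅} := by
    ext s
    simp only [cliquesOn, SimpleGraph.isNClique_zero, Set.mem_ofPred_eq, Set.mem_singleton_iff]
    exact ⟨And.left, fun hs => ⟨hs, by simp [hs]⟩⟩
  rw [h, Set.ncard_singleton]

theorem ncard_cliquesOn_one {V : Type*} (G : SimpleGraph V) (A : Set V) :
    (cliquesOn G A 1).ncard = A.ncard := by
  have h : cliquesOn G A 1 = singleton '' A := by
    ext s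
    simp only [cliquesOn, SimpleGraph.isNClique_one, Set.mem_ofPred_eq, Set.mem_image]
    constructor
    · rintro ⟨⟨a, rfl⟩, ha⟩
      exact ⟨a, ha (by simp), rfl⟩
    · rintro ⟨a, ha, rfl⟩
      exact ⟨⟨a, rfl⟩, by simpa using ha⟩
  rw [h, Set.ncard_image_of_injective _ Finset.singleton_injective]

theorem ncard_cliquesOn_two {V : Type*} (G : SimpleGraph V) (A : Set V) :
    (cliquesOn G A 2).ncard = edgeCnt (G.induce A) := by
  rw [edgeCnt_eq_NK_two, NK_induce]

theorem ncard_cliquesOn_eq_zero {V : Type*} {G : SimpleGraph V} {A : Set V} {m n : ℕ}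
    (hA : (G.induce A).CliqueFree m) (h : m ≤ n) : (cliquesOn G A n).ncard = 0 := by
  have hn := SimpleGraph.CliqueFree.mono h hA
  have hempty : {s | (G.induce A).IsNClique n s} = ∅ :=
    Set.eq_empty_iff_forall_notMem.2 hn
  rw [← NK_induce, NK, hempty, Set.ncard_empty]

/-- The clique numbers of a join are the convolution of those of its two sides. -/
theorem ncard_cliquesOn_union {V : Type*} [Finite V] {G : SimpleGraph V} {A B : Set V}
    (hAB : Disjoint A B) (hadj : ∀ a ∈ A, ∀ b ∈ B, G.Adj a b) (n : ℕ) :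
    (cliquesOn G (A ∪ B) n).ncard =
      ∑ p ∈ Finset.HasAntidiagonal.antidiagonal n, (cliquesOn G A p.1).ncard * (cliquesOn G B p.2).ncard := by
  classical
  have := Fintype.ofFinite V
  simp only [Set.ncard_eq_toFinset_card', ← Finset.card_product]
  rw [← Finset.card_sigma]
  have hdisj : ∀ {s t : Finset V}, (s : Set V) ⊆ A → (t : Set V) ⊆ B → Disjoint s t :=
    fun hs ht => Finset.disjoint_coe.1 (hAB.mono hs ht)
  have hnot : ∀ {x : V}, x ∈ A → x ∉ B := fun hx hx' => Set.disjoint_left.1 hAB hx hx'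
  refine Finset.card_nbij'
    (fun s => ⟨(({x ∈ s | x ∈ A} : Finset V).card, ({x ∈ s | x ∈ B} : Finset V).card),
      ({x ∈ s | x ∈ A}, {x ∈ s | x ∈ B})⟩)
    (fun q => q.2.1 ∪ q.2.2) ?_ ?_ ?_ ?_
  · intro s hs
    have hs' : s ∈ cliquesOn G (A ∪ B) n := by simpa using hs
    obtain ⟨hs, hsub⟩ := hs'
    have hunion : ({x ∈ s | x ∈ A} : Finset V) ∪ ({x ∈ s | x ∈ B} : Finset V) = s := by
      rw [← Finset.filter_or]
      exact Finset.filter_true_of_mem fun x hx => hsub hx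
    have hcard : ({x ∈ s | x ∈ A} : Finset V).card + ({x ∈ s | x ∈ B} : Finset V).card = n := by
      rw [← Finset.card_union_of_disjoint (hdisj (by intro x; simp) (by intro x; simp)), hunion,
        hs.card_eq]
    have hclique : ∀ C : Set V, ({x ∈ s | x ∈ C} : Finset V) ∈
        cliquesOn G C ({x ∈ s | x ∈ C} : Finset V).card := fun C =>
      ⟨⟨hs.isClique.subset (Finset.coe_subset.2 (Finset.filter_subset _ _)), rfl⟩, by intro x; simp⟩
    simp [hcard, hclique]
  · rintro ⟨⟨i, j⟩, s, t⟩ h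
    simp only [Finset.coe_sigma, Set.mem_sigma_iff, Finset.mem_coe, Finset.HasAntidiagonal.mem_antidiagonal,
      Finset.mem_product, Set.mem_toFinset] at h
    obtain ⟨hij, ⟨hs, hsA⟩, ht, htB⟩ := h
    simp only [Set.coe_toFinset]
    refine ⟨⟨?_, ?_⟩, ?_⟩
    · rw [Finset.coe_union]
      rintro x (hx | hx) y (hy | hy) hxy
      · exact hs.isClique hx hy hxy
      · exact hadj x (hsA hx) y (htB hy)
      · exact (hadj y (hsA hy) x (htB hx)).symm
      · exact ht.isClique hx hy hxy
    · rw [Finset.card_union_of_disjoint (hdisj hsA htB), hs.card_eq, ht.card_eq, hij]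
    · rw [Finset.coe_union]
      exact Set.union_subset_union hsA htB
  · intro s hs
    have hs' : s ∈ cliquesOn G (A ∪ B) n := by simpa using hs
    change ({x ∈ s | x ∈ A} : Finset V) ∪ ({x ∈ s | x ∈ B} : Finset V) = s
    rw [← Finset.filter_or]
    exact Finset.filter_true_of_mem fun x hx => hs'.2 hx
  · rintro ⟨⟨i, j⟩, s, t⟩ h
    simp only [Finset.coe_sigma, Set.mem_sigma_iff, Finset.mem_coe, Finset.HasAntidiagonal.mem_antidiagonal,
      Finset.mem_product, Set.mem_toFinset] at h
    obtain ⟨-, ⟨hs, hsA⟩, ht, htB⟩ := h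
    have h1 : ({x ∈ s ∪ t | x ∈ A} : Finset V) = s := by
      ext x
      simp only [Finset.mem_filter, Finset.mem_union]
      exact ⟨fun hx => hx.1.resolve_right fun hxt => hnot hx.2 (htB hxt),
        fun hx => ⟨Or.inl hx, hsA hx⟩⟩
    have h2 : ({x ∈ s ∪ t | x ∈ B} : Finset V) = t := by
      ext x
      simp only [Finset.mem_filter, Finset.mem_union]
      exact ⟨fun hx => hx.1.resolve_left fun hxs => hnot (hsA hxs) hx.2,
        fun hx => ⟨Or.inr hx, htB hx⟩⟩
    simp only [h1, h2, hs.card_eq, ht.card_eq]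

/-- (Fact 2.3) Let `G` be obtained from a complete multipartite graph with
nonempty parts `V_1, …, V_ℓ` (`ℓ ≥ 2`, here `V_j = {v | c v = j}` for `j ∈ [ℓ]`) by adding a
triangle-free graph into each part, let `S := V_1 ∪ V_2` and `S̄ := V ∖ S`. Then for `r ≥ 3`,
`N(K_r, G) = e(G[V_1])·e(G[V_2])·N(K_{r-4}, G[S̄])
  + (e(G[V_1])·|V_2| + e(G[V_2])·|V_1|)·N(K_{r-3}, G[S̄])
  + e(G[S])·N(K_{r-2}, G[S̄]) + |S|·N(K_{r-1}, G[S̄]) + N(K_r, G[S̄])`. -/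
theorem clique_count_two_parts {V : Type*} [Fintype V] (G : SimpleGraph V) (r ℓ : ℕ)
    (hr : 3 ≤ r) (hl : 2 ≤ ℓ) (c : V → ℕ)
    (hc : ∀ v, c v ∈ Finset.Icc 1 ℓ)
    (hne : ∀ j ∈ Finset.Icc 1 ℓ, ∃ v, c v = j)
    (hcomp : ∀ u v, c u ≠ c v → G.Adj u v)
    (htf : ∀ j, (G.induce {v | c v = j}).CliqueFree 3) :
    NK G r =
      edgeCnt (G.induce {v | c v = 1}) * edgeCnt (G.induce {v | c v = 2}) *
          NKZ (G.induce ({v | c v = 1 ∨ c v = 2}ᶜ)) ((r : ℤ) - 4) +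
        (edgeCnt (G.induce {v | c v = 1}) * {v | c v = 2}.ncard +
            edgeCnt (G.induce {v | c v = 2}) * {v | c v = 1}.ncard) *
          NKZ (G.induce ({v | c v = 1 ∨ c v = 2}ᶜ)) ((r : ℤ) - 3) +
        edgeCnt (G.induce {v | c v = 1 ∨ c v = 2}) *
          NKZ (G.induce ({v | c v = 1 ∨ c v = 2}ᶜ)) ((r : ℤ) - 2) +
        {v | c v = 1 ∨ c v = 2}.ncard *
          NKZ (G.induce ({v | c v = 1 ∨ c v = 2}ᶜ)) ((r : ℤ) - 1) +
        NK (G.induce ({v | c v = 1 ∨ c v = 2}ᶜ)) r := by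
  set A : Set V := {v | c v = 1} with hA
  set B : Set V := {v | c v = 2} with hB
  have hSeq : {v | c v = 1 ∨ c v = 2} = A ∪ B := rfl
  rw [hSeq]
  have hjoin : ∀ n, (cliquesOn G (A ∪ B) n).ncard =
      ∑ p ∈ Finset.HasAntidiagonal.antidiagonal n, (cliquesOn G A p.1).ncard * (cliquesOn G B p.2).ncard := by
    refine ncard_cliquesOn_union (Set.disjoint_left.2 fun v h1 h2 => ?_) fun a ha b hb =>
      hcomp a b ?_
    · simp only [hA, hB, Set.mem_ofPred_eq] at h1 h2
      omega
    · simp only [hA, hB, Set.mem_ofPred_eq] at ha hb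
      omega
  have hA0 : ∀ n, 3 ≤ n → (cliquesOn G A n).ncard = 0 := fun n =>
    ncard_cliquesOn_eq_zero (htf 1)
  have hB0 : ∀ n, 3 ≤ n → (cliquesOn G B n).ncard = 0 := fun n =>
    ncard_cliquesOn_eq_zero (htf 2)
  have h3 : (cliquesOn G (A ∪ B) 3).ncard =
      edgeCnt (G.induce A) * B.ncard + edgeCnt (G.induce B) * A.ncard := by
    rw [hjoin]
    simp [Finset.Nat.antidiagonal_succ, hA0, hB0, ncard_cliquesOn_one, ncard_cliquesOn_two]
    ring
  have h4 : (cliquesOn G (A ∪ B) 4).ncard =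
      edgeCnt (G.induce A) * edgeCnt (G.induce B) := by
    rw [hjoin]
    simp [Finset.Nat.antidiagonal_succ, hA0, hB0, ncard_cliquesOn_two]
  have h5 : ∀ n, 5 ≤ n → (cliquesOn G (A ∪ B) n).ncard = 0 := by
    intro n hn
    rw [hjoin]
    refine Finset.sum_eq_zero fun p hp => ?_
    rw [Finset.HasAntidiagonal.mem_antidiagonal] at hp
    rcases le_or_gt 3 p.1 with h | h
    · rw [hA0 _ h, zero_mul]
    · rw [hB0 _ (by omega), mul_zero]
  have htotal : NK G r = ∑ p ∈ Finset.HasAntidiagonal.antidiagonal r,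
      (cliquesOn G (A ∪ B) p.1).ncard * (cliquesOn G (A ∪ B)ᶜ p.2).ncard := by
    rw [← ncard_cliquesOn_union disjoint_compl_right, Set.union_compl_self]
    · simp [NK, cliquesOn]
    · intro a ha b hb
      refine hcomp a b fun hab => hb ?_
      simpa only [hA, hB, Set.mem_union, Set.mem_ofPred_eq, hab] using ha
  rw [htotal, Finset.Nat.sum_antidiagonal_eq_sum_range_succ_mk]
  obtain ⟨k, rfl⟩ := Nat.exists_eq_add_of_le' hr
  have e1 : ((k + 3 : ℕ) : ℤ) - 1 = (k + 2 : ℕ) := by push_cast; ring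
  have e2 : ((k + 3 : ℕ) : ℤ) - 2 = (k + 1 : ℕ) := by push_cast; ring
  have e3 : ((k + 3 : ℕ) : ℤ) - 3 = k := by push_cast; ring
  have hZ : ∀ m : ℕ, NKZ (G.induce (A ∪ B)ᶜ) (m : ℤ) = (cliquesOn G (A ∪ B)ᶜ m).ncard := by
    intro m
    rw [← NK_induce]
    simp [NKZ]
  rw [e1, e2, e3, hZ, hZ, hZ, NK_induce]
  rcases k with _ | k
  · have hneg : NKZ (G.induce (A ∪ B)ᶜ) (((0 + 3 : ℕ) : ℤ) - 4) = 0 := by norm_num [NKZ]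
    rw [hneg]
    simp only [Finset.sum_range_succ, Finset.sum_range_zero, ncard_cliquesOn_zero,
      ncard_cliquesOn_one, ncard_cliquesOn_two, h3, Nat.reduceAdd, Nat.reduceSub]
    ring
  · have e4 : ((k + 1 + 3 : ℕ) : ℤ) - 4 = k := by push_cast; ring
    rw [e4, hZ, ← Finset.sum_subset (Finset.range_subset_range.2 (show 5 ≤ k + 1 + 3 + 1 by omega))]
    · simp only [Finset.sum_range_succ, Finset.sum_range_zero, ncard_cliquesOn_zero,
        ncard_cliquesOn_one, ncard_cliquesOn_two, h3, h4]
      have s1 : k + 1 + 3 - 1 = k + 1 + 2 := by omega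
      have s2 : k + 1 + 3 - 2 = k + 1 + 1 := by omega
      have s3 : k + 1 + 3 - 3 = k + 1 := by omega
      have s4 : k + 1 + 3 - 4 = k := by omega
      rw [s1, s2, s3, s4, Nat.sub_zero]
      ring
    · intro i _ hi
      rw [h5 i (by simpa using hi), zero_mul]
end
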